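/- A central Γ-equivariant extension β: U → G of a Γ-group G is universal if and only if U is Γ-perfect and every central Γ-equivariant extension α: W → U of U splits, i.e. admits a Γ-homomorphism s: U → W with α∘s = id_U. -/

import Mathlib

/-- The Γ-commutator subgroup `[G,G]_Γ` of a Γ-group `G`: the subgroup generated by all
commutators together with the elements `(σ • g) * g⁻¹`. -/
def gammaCommutator (Γ G : Type*) [Group Γ] [Group G] [MulDistribMulAction Γ G] : Subgroup G :=
  Subgroup.closure ({x | ∃ a b : G, x = a * b * a⁻¹ * b⁻¹} ∪
    {x | ∃ (σ : Γ) (g : G), x = σ • g * g⁻¹})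

instance gammaCommutator_normal (Γ G : Type*) [Group Γ] [Group G] [MulDistribMulAction Γ G] :
    (gammaCommutator Γ G).Normal := by
  constructor
  intro n hn g
  have h1 : g * n * g⁻¹ * n⁻¹ ∈ gammaCommutator Γ G :=
    Subgroup.subset_closure (Or.inl ⟨g, n, rfl⟩)
  have h2 := mul_mem h1 hn
  simpa [mul_assoc] using h2

theorem gammaCommutator_smul_mem {Γ G : Type*} [Group Γ] [Group G] [MulDistribMulAction Γ G]
    (σ : Γ) {x : G} (hx : x ∈ gammaCommutator Γ G) : σ • x ∈ gammaCommutator Γ G := by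
  induction hx using Subgroup.closure_induction with
  | mem y hy =>
    rcases hy with ⟨a, b, rfl⟩ | ⟨τ, g, rfl⟩
    · refine Subgroup.subset_closure (Or.inl ⟨σ • a, σ • b, ?_⟩)
      simp [smul_mul', smul_inv']
    · refine Subgroup.subset_closure (Or.inr ⟨σ * τ * σ⁻¹, σ • g, ?_⟩)
      rw [smul_mul', smul_inv', ← mul_smul, ← mul_smul]
      simp [mul_assoc]
  | one => simpa using one_mem (gammaCommutator Γ G)
  | mul a b _ _ iha ihb => rw [smul_mul']; exact mul_mem iha ihb
  | inv a _ iha => rw [smul_inv']; exact inv_mem iha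

instance gammaCommutatorAction (Γ G : Type*) [Group Γ] [Group G] [MulDistribMulAction Γ G] :
    MulDistribMulAction Γ (gammaCommutator Γ G) where
  smul σ x := ⟨σ • (x : G), gammaCommutator_smul_mem σ x.2⟩
  one_smul x := Subtype.ext (one_smul Γ (x : G))
  mul_smul σ τ x := Subtype.ext (mul_smul σ τ (x : G))
  smul_mul σ x y := Subtype.ext (smul_mul' σ (x : G) (y : G))
  smul_one σ := Subtype.ext (smul_one σ)

instance gammaAbelianization_commGroup (Γ G : Type*) [Group Γ] [Group G]
    [MulDistribMulAction Γ G] : CommGroup (G ⧸ gammaCommutator Γ G) where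
  mul_comm a b := by
    induction a using QuotientGroup.induction_on with
    | _ x =>
    induction b using QuotientGroup.induction_on with
    | _ y =>
    rw [← QuotientGroup.mk_mul, ← QuotientGroup.mk_mul, QuotientGroup.eq]
    exact Subgroup.subset_closure (Or.inl ⟨y⁻¹, x⁻¹, by group⟩)

universe u v

/-- `φ : B →* G` is a central Γ-equivariant extension of the Γ-group `G`. -/
def IsCentralGammaExt (Γ : Type u) [Group Γ] {B G : Type v} [Group B] [Group G]
    [MulDistribMulAction Γ B] [MulDistribMulAction Γ G] (φ : B →* G) : Prop :=
  (∀ (σ : Γ) (b : B), φ (σ • b) = σ • φ b) ∧ Function.Surjective φ ∧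
    φ.ker ≤ Subgroup.center B ∧ (∀ (σ : Γ), ∀ b ∈ φ.ker, σ • b = b) ∧
    ∃ γ : G → B, (∀ (σ : Γ) (g : G), γ (σ • g) = σ • γ g) ∧ ∀ g, φ (γ g) = g

/-- A central Γ-equivariant extension `β : U →* G` is universal if for every central
Γ-equivariant extension `α : X →* G` there is a unique Γ-homomorphism `U →* X` over `G`. -/
def IsUniversalCentralGammaExt (Γ : Type u) [Group Γ] {U G : Type v} [Group U] [Group G]
    [MulDistribMulAction Γ U] [MulDistribMulAction Γ G] (β : U →* G) : Prop :=
  IsCentralGammaExt Γ β ∧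
    ∀ (X : Type v) [Group X] [MulDistribMulAction Γ X] (α : X →* G),
      IsCentralGammaExt Γ α →
        ∃! f : U →* X, (∀ (σ : Γ) (u : U), f (σ • u) = σ • f u) ∧ α.comp f = β

/-- A homomorphism from a Γ-perfect group which is Γ-invariant and has commuting values
is trivial. -/
theorem MonoidHom.eq_one_of_gammaCommutator_eq_top {Γ U M : Type*} [Group Γ] [Group U] [Group M]
    [MulDistribMulAction Γ U] (hU : gammaCommutator Γ U = ⊤) (χ : U →* M)
    (hcomm : ∀ a b, Commute (χ a) (χ b)) (hinv : ∀ (σ : Γ) (u : U), χ (σ • u) = χ u) (u : U) :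
    χ u = 1 := by
  have h : gammaCommutator Γ U ≤ χ.ker := by
    refine (Subgroup.closure_le _).2 ?_
    rintro _ (⟨a, b, rfl⟩ | ⟨σ, g, rfl⟩)
    · simp [MonoidHom.mem_ker, (hcomm a b).eq]
    · simp [MonoidHom.mem_ker, hinv]
  exact h (hU ▸ Subgroup.mem_top u)

/-- Two Γ-homomorphisms from a Γ-perfect group over the base of a central Γ-equivariant
extension agree. -/
theorem IsCentralGammaExt.hom_ext {Γ : Type u} [Group Γ] {U X G : Type v}
    [Group U] [Group X] [Group G] [MulDistribMulAction Γ U] [MulDistribMulAction Γ X]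
    [MulDistribMulAction Γ G] {α : X →* G} (hα : IsCentralGammaExt Γ α)
    (hU : gammaCommutator Γ U = ⊤) {f g : U →* X}
    (hf : ∀ (σ : Γ) (u : U), f (σ • u) = σ • f u) (hg : ∀ (σ : Γ) (u : U), g (σ • u) = σ • g u)
    (hfg : α.comp f = α.comp g) : f = g := by
  obtain ⟨-, -, hcen, htriv, -⟩ := hα
  have hker (u : U) : f u * (g u)⁻¹ ∈ α.ker := by
    have : α (f u) = α (g u) := DFunLike.congr_fun hfg u
    simp [MonoidHom.mem_ker, this]
  have hcomm (u : U) (x : X) : x * (f u * (g u)⁻¹) = f u * (g u)⁻¹ * x :=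
    Subgroup.mem_center_iff.1 (hcen (hker u)) x
  let χ : U →* X :=
    { toFun := fun u => f u * (g u)⁻¹
      map_one' := by simp
      map_mul' := fun a b => by
        calc f (a * b) * (g (a * b))⁻¹ = f a * (f b * (g b)⁻¹) * (g a)⁻¹ := by
              simp [mul_assoc]
          _ = f a * (g a)⁻¹ * (f b * (g b)⁻¹) := by
              rw [mul_assoc, ← hcomm b, ← mul_assoc] }
  ext u
  refine mul_inv_eq_one.1 (MonoidHom.eq_one_of_gammaCommutator_eq_top hU χ
    (fun a b => hcomm b _) (fun σ u => ?_) u)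
  calc f (σ • u) * (g (σ • u))⁻¹ = σ • (f u * (g u)⁻¹) := by
        rw [hf, hg, smul_mul', smul_inv']
    _ = f u * (g u)⁻¹ := htriv σ _ (hker u)

/-- The composite of central Γ-equivariant extensions is again one when the intermediate
Γ-group is Γ-perfect. -/
theorem IsCentralGammaExt.comp {Γ : Type u} [Group Γ] {W U G : Type v}
    [Group W] [Group U] [Group G] [MulDistribMulAction Γ W] [MulDistribMulAction Γ U]
    [MulDistribMulAction Γ G] {β : U →* G} {α : W →* U} (hβ : IsCentralGammaExt Γ β)
    (hα : IsCentralGammaExt Γ α) (hU : gammaCommutator Γ U = ⊤) :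
    IsCentralGammaExt Γ (β.comp α) := by
  obtain ⟨hβeq, hβsurj, hβcen, hβtriv, δ, hδ, hβδ⟩ := hβ
  obtain ⟨hαeq, hαsurj, hαcen, hαtriv, γ, hγ, hαγ⟩ := hα
  have hfix (σ : Γ) (w : W) (hw : w ∈ (β.comp α).ker) : σ • w = w := by
    have hk : (γ (α w))⁻¹ * w ∈ α.ker := by simp [MonoidHom.mem_ker, hαγ]
    calc σ • w = σ • (γ (α w) * ((γ (α w))⁻¹ * w)) := by simp
      _ = γ (α w) * ((γ (α w))⁻¹ * w) := by
          rw [smul_mul', hαtriv σ _ hk, ← hγ, hβtriv σ (α w) hw]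
      _ = w := by simp
  refine ⟨fun σ w => by simp [hαeq, hβeq], hβsurj.comp hαsurj, fun w₀ hw₀ => ?_, hfix,
    fun g => γ (δ g), fun σ g => by simp [hδ, hγ], fun g => by simp [hαγ, hβδ]⟩
  have hc (w : W) : w * w₀ * w⁻¹ * w₀⁻¹ ∈ α.ker := by
    have : α w * α w₀ = α w₀ * α w := Subgroup.mem_center_iff.1 (hβcen hw₀) (α w)
    simp [MonoidHom.mem_ker, this]
  have hcomm (w x : W) : x * (w * w₀ * w⁻¹ * w₀⁻¹) = w * w₀ * w⁻¹ * w₀⁻¹ * x :=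
    Subgroup.mem_center_iff.1 (hαcen (hc w)) x
  let χ : W →* W :=
    { toFun := fun w => w * w₀ * w⁻¹ * w₀⁻¹
      map_one' := by simp
      map_mul' := fun a b => by
        calc a * b * w₀ * (a * b)⁻¹ * w₀⁻¹
            = a * (b * w₀ * b⁻¹ * w₀⁻¹) * (w₀ * a⁻¹ * w₀⁻¹) := by group
          _ = a * w₀ * a⁻¹ * w₀⁻¹ * (b * w₀ * b⁻¹ * w₀⁻¹) := by
              rw [mul_assoc, ← hcomm b]; group }
  have hχker : α.ker ≤ χ.ker := fun k hk => by
    have : w₀ * k = k * w₀ := Subgroup.mem_center_iff.1 (hαcen hk) w₀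
    change k * w₀ * k⁻¹ * w₀⁻¹ = 1
    rw [← this]; group
  have hχinv (σ : Γ) (w : W) : χ (σ • w) = χ w := by
    have h := hαtriv σ _ (hc w)
    rwa [smul_mul', smul_mul', smul_mul', smul_inv', smul_inv', hfix σ w₀ hw₀] at h
  let ψ : U →* W := α.liftOfSurjective hαsurj ⟨χ, hχker⟩
  have hψ (w : W) : ψ (α w) = χ w :=
    α.liftOfRightInverse_comp_apply _ (Function.rightInverse_surjInv hαsurj) ⟨χ, hχker⟩ w
  rw [Subgroup.mem_center_iff]
  intro w
  have h1 : ψ (α w) = 1 := by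
    refine MonoidHom.eq_one_of_gammaCommutator_eq_top hU ψ (fun a b => ?_) (fun σ u => ?_) _
    · obtain ⟨a, rfl⟩ := hαsurj a
      obtain ⟨b, rfl⟩ := hαsurj b
      rw [hψ, hψ]
      exact hcomm b _
    · obtain ⟨w, rfl⟩ := hαsurj u
      rw [← hαeq, hψ, hψ, hχinv]
  rw [hψ] at h1
  exact mul_inv_eq_iff_eq_mul.1 (mul_inv_eq_one.1 h1)

/-- The domain of a universal central Γ-equivariant extension is Γ-perfect. -/
theorem IsUniversalCentralGammaExt.gammaCommutator_eq_top {Γ : Type u} [Group Γ] {U G : Type v}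
    [Group U] [Group G] [MulDistribMulAction Γ U] [MulDistribMulAction Γ G] {β : U →* G}
    (h : IsUniversalCentralGammaExt Γ β) : gammaCommutator Γ U = ⊤ := by
  obtain ⟨⟨hβ, -⟩, huniv⟩ := h
  let _ : MulDistribMulAction Γ (U ⧸ gammaCommutator Γ U) :=
    { smul := fun _ a => a
      one_smul := fun _ => rfl
      mul_smul := fun _ _ _ => rfl
      smul_mul := fun _ _ _ => rfl
      smul_one := fun _ => rfl }
  have hsmul (σ : Γ) (a : U ⧸ gammaCommutator Γ U) : σ • a = a := rfl
  have hα : IsCentralGammaExt Γ (MonoidHom.fst G (U ⧸ gammaCommutator Γ U)) := by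
    refine ⟨fun _ _ => rfl, Prod.fst_surjective, ?_, ?_, fun g => (g, 1), fun σ g => ?_,
      fun _ => rfl⟩
    · rintro ⟨g, a⟩ (rfl : g = 1)
      rw [Subgroup.mem_center_iff]
      rintro ⟨g', a'⟩
      exact Prod.ext (by simp) (mul_comm a' a)
    · rintro σ ⟨g, a⟩ (rfl : g = 1)
      exact Prod.ext (smul_one σ) rfl
    · exact Prod.ext rfl rfl
  have hmk (σ : Γ) (u : U) : (QuotientGroup.mk' (gammaCommutator Γ U)) (σ • u) =
      QuotientGroup.mk' (gammaCommutator Γ U) u := by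
    rw [← mul_inv_eq_one, ← map_inv, ← map_mul]
    exact (QuotientGroup.eq_one_iff _).2 (Subgroup.subset_closure (Or.inr ⟨σ, u, rfl⟩))
  have heq : β.prod (QuotientGroup.mk' (gammaCommutator Γ U)) = β.prod 1 :=
    (huniv _ _ hα).unique
      ⟨fun σ u => Prod.ext (hβ σ u) (hmk σ u), rfl⟩ ⟨fun σ u => Prod.ext (hβ σ u) rfl, rfl⟩
  refine (Subgroup.eq_top_iff' _).2 fun u => ?_
  exact (QuotientGroup.eq_one_iff u).1 (congrArg Prod.snd (DFunLike.congr_fun heq u))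

/-- If every central Γ-equivariant extension of `U` splits, then any Γ-homomorphism `β : U →* G`
lifts along every central Γ-equivariant extension of `G`. -/
theorem IsCentralGammaExt.exists_lift_of_splits {Γ : Type u} [Group Γ] {U X G : Type v}
    [Group U] [Group X] [Group G] [MulDistribMulAction Γ U] [MulDistribMulAction Γ X]
    [MulDistribMulAction Γ G] {α : X →* G} (hα : IsCentralGammaExt Γ α) {β : U →* G}
    (hβ : ∀ (σ : Γ) (u : U), β (σ • u) = σ • β u)
    (hsplit : ∀ (W : Type v) [Group W] [MulDistribMulAction Γ W] (p : W →* U),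
      IsCentralGammaExt Γ p →
        ∃ s : U →* W, (∀ (σ : Γ) (u : U), s (σ • u) = σ • s u) ∧ p.comp s = MonoidHom.id U) :
    ∃ f : U →* X, (∀ (σ : Γ) (u : U), f (σ • u) = σ • f u) ∧ α.comp f = β := by
  obtain ⟨hαeq, -, hcen, htriv, γ, hγ, hαγ⟩ := hα
  let P : Subgroup (U × X) :=
    (β.comp (MonoidHom.fst U X)).eqLocus (α.comp (MonoidHom.snd U X))
  have hP (p : P) : β p.1.1 = α p.1.2 := p.2
  let _ : MulDistribMulAction Γ P :=
    { smul := fun σ p => ⟨σ • p.1, by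
        change β (σ • p.1.1) = α (σ • p.1.2)
        rw [hβ, hαeq, hP]⟩
      one_smul := fun p => Subtype.ext (one_smul Γ p.1)
      mul_smul := fun σ τ p => Subtype.ext (mul_smul σ τ p.1)
      smul_mul := fun σ p q => Subtype.ext (smul_mul' σ p.1 q.1)
      smul_one := fun σ => Subtype.ext (smul_one σ) }
  have hker (p : P) (hp : p.1.1 = 1) : p.1.2 ∈ α.ker := by
    rw [MonoidHom.mem_ker, ← hP, hp, map_one]
  obtain ⟨s, hs, hps⟩ := hsplit P ((MonoidHom.fst U X).comp P.subtype) (by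
    refine ⟨fun _ _ => rfl, fun u => ⟨⟨(u, γ (β u)), (hαγ _).symm⟩, rfl⟩, fun p hp => ?_,
      fun σ p hp => ?_, fun u => ⟨(u, γ (β u)), (hαγ _).symm⟩, fun σ u => ?_, fun _ => rfl⟩
    · have hp1 : p.1.1 = 1 := hp
      rw [Subgroup.mem_center_iff]
      intro q
      refine Subtype.ext (Prod.ext ?_ (Subgroup.mem_center_iff.1 (hcen (hker p hp1)) q.1.2))
      simp [hp1]
    · have hp1 : p.1.1 = 1 := hp
      refine Subtype.ext (Prod.ext ?_ (htriv σ _ (hker p hp1)))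
      change σ • p.1.1 = p.1.1
      rw [hp1, smul_one]
    · refine Subtype.ext (Prod.ext rfl ?_)
      change γ (β (σ • u)) = σ • γ (β u)
      rw [hβ, hγ])
  refine ⟨(MonoidHom.snd U X).comp (P.subtype.comp s), fun σ u => ?_, ?_⟩
  · change (s (σ • u)).1.2 = σ • (s u).1.2
    rw [hs]
    rfl
  · ext u
    have hu : (s u).1.1 = u := DFunLike.congr_fun hps u
    change α (s u).1.2 = β u
    rw [← hP, hu]

/-- A central Γ-equivariant extension `β : U →* G` of a Γ-group `G` is
universal if and only if `U` is Γ-perfect and every central Γ-equivariant extension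
`α : W →* U` of `U` splits by a Γ-homomorphism. -/
theorem isUniversal_iff_gammaPerfect_and_splits {Γ : Type u} [Group Γ] {U G : Type v}
    [Group U] [Group G] [MulDistribMulAction Γ U] [MulDistribMulAction Γ G]
    (β : U →* G) (hβ : IsCentralGammaExt Γ β) :
    IsUniversalCentralGammaExt Γ β ↔
      (gammaCommutator Γ U = ⊤ ∧
        ∀ (W : Type v) [Group W] [MulDistribMulAction Γ W] (α : W →* U),
          IsCentralGammaExt Γ α →
            ∃ s : U →* W, (∀ (σ : Γ) (u : U), s (σ • u) = σ • s u) ∧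
              α.comp s = MonoidHom.id U) := by
  constructor
  · intro h
    have hU := h.gammaCommutator_eq_top
    refine ⟨hU, fun W _ _ α hα => ?_⟩
    obtain ⟨s, ⟨hs, hαs⟩, -⟩ := h.2 W (β.comp α) (hβ.comp hα hU)
    refine ⟨s, hs, hβ.hom_ext hU (fun σ u => ?_) (fun _ _ => rfl) hαs⟩
    simp [hs, hα.1]
  · rintro ⟨hU, hsplit⟩
    refine ⟨hβ, fun X _ _ α hα => ?_⟩
    obtain ⟨f, hf, hαf⟩ := hα.exists_lift_of_splits hβ.1 hsplit
    exact ⟨f, ⟨hf, hαf⟩, fun g ⟨hg, hαg⟩ => hα.hom_ext hU hg hf (hαg.trans hαf.symm)⟩
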